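/- arXiv:2206.08827 — 2 statements merged into one kernel-verified Lean document; each statement's English description precedes it below -/
import Mathlib

section
/- Let K be an algebraically closed field and p ∈ K⟨x_1,...,x_n⟩ a polynomial with zero constant term such that p does not vanish identically on K. Then the image p(T_m(K)) = {p(u_1,...,u_n) : u_i ∈ T_m(K)} is Zariski dense in T_m(K) ≅ K^{m(m+1)/2}. -/
theorem stmt9 {K : Type*} [Field K] [IsAlgClosed K] {n m : ℕ}
    (p : FreeAlgebra K (Fin n))
    (h0 : (FreeAlgebra.lift K (fun _ : Fin n => (0 : K))) p = 0)
    (hK : ∃ c : Fin n → K, (FreeAlgebra.lift K c) p ≠ 0)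
    (f : MvPolynomial {q : Fin m × Fin m // q.1 ≤ q.2} K)
    (hf : ∃ x : {q : Fin m × Fin m // q.1 ≤ q.2} → K,
      MvPolynomial.eval x f ≠ 0) :
    ∃ u : Fin n → Matrix (Fin m) (Fin m) K,
      (∀ i, (u i).BlockTriangular id) ∧
      MvPolynomial.eval
        (fun q => ((FreeAlgebra.lift K u) p) q.1.1 q.1.2) f ≠ 0 := by
  classical
  obtain ⟨c, hc⟩ := hK
  have : Infinite K := IsAlgClosed.instInfinite
  -- restriction of `p` to the line through `c`
  let q : Polynomial K := FreeAlgebra.lift K (fun i => c i • (Polynomial.X : Polynomial K)) p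
  have hq : ∀ {B : Type _} [Ring B] [Algebra K B] (b : B),
      Polynomial.aeval b q = FreeAlgebra.lift K (fun i => c i • b) p := by
    intro B _ _ b
    have : (Polynomial.aeval b).comp
        (FreeAlgebra.lift K (fun i => c i • (Polynomial.X : Polynomial K))) =
        FreeAlgebra.lift K (fun i => c i • b) := by
      ext i
      simp
    exact DFunLike.congr_fun this p
  have hq0 : Polynomial.eval 0 q = 0 := by
    have := hq (0 : K)
    simp only [smul_zero, h0] at this
    rwa [Polynomial.coe_aeval_eq_eval] at this
  have hq1 : Polynomial.eval 1 q ≠ 0 := by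
    have := hq (1 : K)
    simp only [smul_eq_mul, mul_one] at this
    rw [Polynomial.coe_aeval_eq_eval] at this
    rw [this]; exact hc
  have hsurj : ∀ a : K, ∃ e, Polynomial.eval e q = a := by
    intro a
    have hd : (q - Polynomial.C a).degree ≠ 0 := by
      intro h
      have h2 := Polynomial.eq_C_of_degree_eq_zero h
      have e0 := congrArg (Polynomial.eval 0) h2
      have e1 := congrArg (Polynomial.eval 1) h2
      simp only [Polynomial.eval_sub, Polynomial.eval_C] at e0 e1
      apply hq1
      rw [← hq0]
      exact sub_left_injective (e1.trans e0.symm)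
    obtain ⟨e, he⟩ := IsAlgClosed.exists_root _ hd
    refine ⟨e, ?_⟩
    simpa [Polynomial.IsRoot, sub_eq_zero] using he
  -- a point with distinct diagonal entries where `f` does not vanish
  let d : Fin m → {q : Fin m × Fin m // q.1 ≤ q.2} := fun i => ⟨(i, i), le_rfl⟩
  have hd : Function.Injective d := by
    intro i j h
    simpa [d] using h
  have hf0 : f ≠ 0 := by
    rintro rfl
    simp at hf
  let g : MvPolynomial {q : Fin m × Fin m // q.1 ≤ q.2} K :=
    ∏ ij ∈ (Finset.univ : Finset (Fin m)).offDiag,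
      (MvPolynomial.X (d ij.1) - MvPolynomial.X (d ij.2))
  have hg : g ≠ 0 := by
    refine Finset.prod_ne_zero_iff.mpr ?_
    intro ij hij
    have hne := (Finset.mem_offDiag.mp hij).2.2
    rw [sub_ne_zero]
    intro h
    exact hne (hd (MvPolynomial.X_injective h))
  obtain ⟨x, hx⟩ : ∃ x, MvPolynomial.eval x (f * g) ≠ 0 := by
    by_contra! h
    exact mul_ne_zero hf0 hg (MvPolynomial.funext (fun x => by simpa using h x))
  rw [map_mul] at hx
  have hxf := left_ne_zero_of_mul hx
  have hxg := right_ne_zero_of_mul hx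
  have hinj : Function.Injective (fun i => x (d i)) := by
    intro i j hij
    by_contra hne
    apply hxg
    rw [map_prod]
    apply Finset.prod_eq_zero (i := (i, j)) (by simpa using hne)
    simpa [sub_eq_zero] using hij
  let A : Matrix (Fin m) (Fin m) K := fun i j => if h : i ≤ j then x ⟨(i, j), h⟩ else 0
  have hA : A.BlockTriangular id := by
    intro i j hij
    have : ¬ i ≤ j := not_le.mpr hij
    simp [A, this]
  choose e he using hsurj
  let r : Polynomial K := Lagrange.interpolate Finset.univ (fun i => x (d i)) (fun i => e (x (d i)))
  have hr : ∀ i, Polynomial.eval (x (d i)) r = e (x (d i)) := fun i =>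
    Lagrange.eval_interpolate_at_node (v := fun i => x (d i)) (fun i => e (x (d i)))
      hinj.injOn (Finset.mem_univ i)
  have hdvd : A.charpoly ∣ q.comp r - Polynomial.X := by
    rw [Matrix.charpoly_of_upperTriangular A hA]
    apply Finset.prod_dvd_of_coprime
    · intro i _ j _ hij
      have : A i i ≠ A j j := by
        simpa [A] using hinj.ne hij
      exact Polynomial.pairwise_coprime_X_sub_C Function.injective_id this
    · intro i _
      rw [Polynomial.dvd_iff_isRoot]
      have : A i i = x (d i) := by simp [A, d]
      simp [Polynomial.IsRoot, this, hr, he]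
  have hcomp : Polynomial.aeval (Polynomial.aeval A r) q = A := by
    obtain ⟨s, hs⟩ := hdvd
    have := congrArg (Polynomial.aeval A) hs
    rw [map_mul, Matrix.aeval_self_charpoly, zero_mul, map_sub, Polynomial.aeval_X,
      Polynomial.aeval_comp, sub_eq_zero] at this
    exact this
  have htri : (Polynomial.aeval A r).BlockTriangular id := by
    induction r using Polynomial.induction_on' with
    | add a b ha hb => rw [map_add]; exact ha.add hb
    | monomial k a => 
      rw [Polynomial.aeval_monomial, ← Algebra.smul_def]
      have hp : (A ^ k).BlockTriangular id := by
        induction k with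
        | zero => rw [pow_zero]; exact Matrix.blockTriangular_one
        | succ k ih => rw [pow_succ]; exact ih.mul hA
      intro i j hij
      simp [hp hij]
  refine ⟨fun i => c i • Polynomial.aeval A r, ?_, ?_⟩
  · intro i a b hab
    simp [htri hab]
  · rw [← hq, hcomp]
    have hx' : (fun w : {q : Fin m × Fin m // q.1 ≤ q.2} => A w.1.1 w.1.2) = x := by
      funext w
      exact dif_pos w.2
    rw [hx']
    exact hxf
end

section
/- Let K be an algebraically closed field and w a nontrivial element of the free group F_n that is not a group law on the group T_m(K)^× of invertible upper triangular m×m matrices. If every diagonal torus element diag(a_1,...,a_m) with a_i ∈ K^× and a_i pairwise distinct belongs to the image w(T_m(K)^×), then w(T_m(K)^×) is Zariski dense in T_m(K)^×. -/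
/-- The subalgebra of upper triangular `m × m` matrices over `K`. -/
def upperTriangularAlg (K : Type*) [Field K] (m : ℕ) :
    Subalgebra K (Matrix (Fin m) (Fin m) K) :=
  { carrier := {A : Matrix (Fin m) (Fin m) K | A.BlockTriangular id}
    mul_mem' := fun ha hb => ha.mul hb
    add_mem' := fun ha hb => ha.add hb
    zero_mem' := Matrix.blockTriangular_zero
    one_mem' := Matrix.blockTriangular_one
    algebraMap_mem' := fun _ => Matrix.blockTriangular_diagonal _ }

open Polynomial in
/-- The product of the `A - a i` for `i < s`. -/
noncomputable def partialProd {K : Type*} [Field K] {m : ℕ} (A : Matrix (Fin m) (Fin m) K)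
    (a : ℕ → K) (s : ℕ) : Matrix (Fin m) (Fin m) K :=
  aeval A (∏ i ∈ Finset.range s, (X - C (a i)))

lemma partialProd_succ {K : Type*} [Field K] {m : ℕ} (A : Matrix (Fin m) (Fin m) K)
    (a : ℕ → K) (s : ℕ) :
    partialProd A a (s + 1) = partialProd A a s * (A - algebraMap K _ (a s)) := by
  simp [partialProd, Finset.prod_range_succ]

lemma partialProd_succ' {K : Type*} [Field K] {m : ℕ} (A : Matrix (Fin m) (Fin m) K)
    (a : ℕ → K) (s : ℕ) :
    partialProd A a (s + 1) = (A - algebraMap K _ (a s)) * partialProd A a s := by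
  rw [partialProd, Finset.prod_range_succ, mul_comm]
  simp [partialProd]

lemma sub_tri {K : Type*} [Field K] {m : ℕ} {A : Matrix (Fin m) (Fin m) K}
    (hA : A.BlockTriangular id) (c : K) :
    (A - algebraMap K (Matrix (Fin m) (Fin m) K) c).BlockTriangular id :=
  hA.sub (Matrix.blockTriangular_diagonal _)

lemma partialProd_tri {K : Type*} [Field K] {m : ℕ} {A : Matrix (Fin m) (Fin m) K}
    (hA : A.BlockTriangular id) (a : ℕ → K) (s : ℕ) :
    (partialProd A a s).BlockTriangular id := by
  induction s with
  | zero => simpa [partialProd] using Matrix.blockTriangular_one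
  | succ s ih =>
    rw [partialProd_succ]
    exact ih.mul (sub_tri hA _)

lemma tri_mul_diag {K : Type*} [Field K] {m : ℕ} {A B : Matrix (Fin m) (Fin m) K}
    (hA : A.BlockTriangular id) (hB : B.BlockTriangular id) (i : Fin m) :
    (A * B) i i = A i i * B i i := by
  rw [Matrix.mul_apply, Finset.sum_eq_single i]
  · intro l _ hl
    rcases lt_or_gt_of_ne hl with h | h
    · rw [hA (by exact h), zero_mul]
    · rw [hB (by exact h), mul_zero]
  · simp

lemma partialProd_diag {K : Type*} [Field K] {m : ℕ} {A : Matrix (Fin m) (Fin m) K}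
    (hA : A.BlockTriangular id) (a : ℕ → K) (s : ℕ) (i : Fin m) :
    partialProd A a s i i = ∏ k ∈ Finset.range s, (A i i - a k) := by
  induction s with
  | zero => simp [partialProd]
  | succ s ih =>
    rw [partialProd_succ, tri_mul_diag (partialProd_tri hA a s) (sub_tri hA _), ih,
      Finset.prod_range_succ]
    simp [Matrix.algebraMap_matrix_apply]

lemma partialProd_col {K : Type*} [Field K] {m : ℕ} {A : Matrix (Fin m) (Fin m) K}
    (hA : A.BlockTriangular id) (a : ℕ → K) (ha : ∀ i : Fin m, a i = A i i) (s : ℕ)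
    (k : Fin m) (hk : (k : ℕ) < s) (i : Fin m) :
    partialProd A a s i k = 0 := by
  induction s generalizing k with
  | zero => omega
  | succ s ih =>
    rw [partialProd_succ, Matrix.mul_apply]
    refine Finset.sum_eq_zero fun l _ => ?_
    by_cases hl : (l : ℕ) < s
    · rw [ih l hl, zero_mul]
    · by_cases hlk : l = k
      · subst hlk
        have : s = (l : ℕ) := by omega
        subst this
        simp [Matrix.algebraMap_matrix_apply, ha]
      · have : k < l := by
          rw [Fin.lt_def]
          have : (l : ℕ) ≠ k := fun h => hlk (Fin.ext h)
          omega
        rw [sub_tri hA _ (by exact this), mul_zero]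

lemma exists_unit {K : Type*} [Field K] {m : ℕ} {A : Matrix (Fin m) (Fin m) K}
    (hA : A.BlockTriangular id) (h : ∀ i, A i i ≠ 0) :
    ∃ u : (upperTriangularAlg K m)ˣ,
      ((u : upperTriangularAlg K m) : Matrix (Fin m) (Fin m) K) = A := by
  have hdet : IsUnit A.det := by
    rw [Matrix.det_of_upperTriangular hA]
    exact (Finset.prod_ne_zero_iff.2 fun i _ => h i).isUnit
  haveI : Invertible A := Matrix.invertibleOfIsUnitDet A hdet
  refine ⟨⟨⟨A, hA⟩, ⟨A⁻¹, Matrix.blockTriangular_inv_of_blockTriangular hA⟩, ?_, ?_⟩, rfl⟩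
  · exact Subtype.ext (Matrix.mul_nonsing_inv A hdet)
  · exact Subtype.ext (Matrix.nonsing_inv_mul A hdet)

lemma exists_conj {K : Type*} [Field K] {m : ℕ} {A : Matrix (Fin m) (Fin m) K}
    (hA : A.BlockTriangular id) (h : ∀ i j, i ≠ j → A i i ≠ A j j) :
    ∃ u : (upperTriangularAlg K m)ˣ,
      A * ((u : upperTriangularAlg K m) : Matrix (Fin m) (Fin m) K) =
      ((u : upperTriangularAlg K m) : Matrix (Fin m) (Fin m) K) *
        Matrix.diagonal (fun i => A i i) := by
  let a : ℕ → K := fun i => if h : i < m then A ⟨i, h⟩ ⟨i, h⟩ else 0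
  have ha : ∀ i : Fin m, a i = A i i := fun i => by simp [a]
  let P : Matrix (Fin m) (Fin m) K := Matrix.of fun i j => partialProd A a j i j
  have hP : P.BlockTriangular id := fun i j hij => partialProd_tri hA a j hij
  have hd : ∀ i, P i i ≠ 0 := by
    intro i
    change partialProd A a i i i ≠ 0
    rw [partialProd_diag hA]
    refine Finset.prod_ne_zero_iff.2 fun k hk => ?_
    have hk := Finset.mem_range.1 hk
    have := ha ⟨k, hk.trans i.2⟩
    simp only at this
    rw [this, sub_ne_zero]
    refine h _ _ fun e => ?_
    rw [e] at hk
    simp at hk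
  obtain ⟨u, hu⟩ := exists_unit hP hd
  refine ⟨u, ?_⟩
  rw [hu]
  ext i j
  have h1 := partialProd_col hA a ha (j + 1) j (by omega) i
  rw [partialProd_succ', sub_mul, Matrix.sub_apply, sub_eq_zero, ha,
    ← Algebra.smul_def, Matrix.smul_apply, smul_eq_mul] at h1
  rw [Matrix.mul_diagonal, mul_comm (P i j)]
  exact h1

/-- If `w` is a nontrivial word that is not a group law on the group
`T_m(K)ˣ` of invertible upper triangular matrices, and every diagonal
matrix with pairwise distinct nonzero diagonal entries lies in the image
of the word map of `w`, then the image of the word map of `w` is Zariski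
dense in `T_m(K)ˣ`. -/
theorem stmt16 {K : Type*} [Field K] [IsAlgClosed K] {n m : ℕ}
    (w : FreeGroup (Fin n)) (hw : w ≠ 1)
    (hlaw : ∃ g : Fin n → (upperTriangularAlg K m)ˣ, (FreeGroup.lift g) w ≠ 1)
    (hdiag : ∀ a : Fin m → Kˣ, (∀ i j, i ≠ j → a i ≠ a j) →
      ∃ g : Fin n → (upperTriangularAlg K m)ˣ,
        ((((FreeGroup.lift g) w : (upperTriangularAlg K m)ˣ) :
            upperTriangularAlg K m) : Matrix (Fin m) (Fin m) K)
          = Matrix.diagonal (fun i => (a i : K))) :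
    ∀ f : MvPolynomial {q : Fin m × Fin m // q.1 ≤ q.2} K,
      (∃ g₀ : (upperTriangularAlg K m)ˣ,
        MvPolynomial.eval
          (fun q => (((g₀ : upperTriangularAlg K m) :
            Matrix (Fin m) (Fin m) K)) q.1.1 q.1.2) f ≠ 0) →
      ∃ g : Fin n → (upperTriangularAlg K m)ˣ,
        MvPolynomial.eval
          (fun q => ((((FreeGroup.lift g) w : (upperTriangularAlg K m)ˣ) :
            upperTriangularAlg K m) : Matrix (Fin m) (Fin m) K) q.1.1 q.1.2)
          f ≠ 0 := by
  intro f ⟨g₀, hg₀⟩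
  have hf : f ≠ 0 := by
    rintro rfl
    simp at hg₀
  let Y : Fin m → MvPolynomial {q : Fin m × Fin m // q.1 ≤ q.2} K :=
    fun i => MvPolynomial.X ⟨(i, i), le_refl i⟩
  have hY : (f * ∏ i, Y i) * ∏ p : Fin m × Fin m with p.1 ≠ p.2, (Y p.1 - Y p.2) ≠ 0 := by
    refine mul_ne_zero (mul_ne_zero hf ?_) ?_
    · exact Finset.prod_ne_zero_iff.2 fun i _ => MvPolynomial.X_ne_zero _
    · refine Finset.prod_ne_zero_iff.2 fun p hp => ?_
      rw [sub_ne_zero]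
      intro e
      have := MvPolynomial.X_injective e
      simp at this hp
      exact hp this
  haveI : Infinite K := IsAlgClosed.instInfinite
  obtain ⟨x, hx⟩ : ∃ x, MvPolynomial.eval x
      ((f * ∏ i, Y i) * ∏ p : Fin m × Fin m with p.1 ≠ p.2, (Y p.1 - Y p.2)) ≠ 0 := by
    by_contra! hc
    exact hY (MvPolynomial.funext fun x => by rw [hc x, map_zero])
  rw [map_mul, map_mul, map_prod, map_prod] at hx
  have hx1 := left_ne_zero_of_mul (left_ne_zero_of_mul hx)
  have hx2 := Finset.prod_ne_zero_iff.1 (right_ne_zero_of_mul (left_ne_zero_of_mul hx))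
  have hx3 := Finset.prod_ne_zero_iff.1 (right_ne_zero_of_mul hx)
  let A : Matrix (Fin m) (Fin m) K :=
    Matrix.of fun i j => if h : i ≤ j then x ⟨(i, j), h⟩ else 0
  have hA : A.BlockTriangular id := by
    intro i j hij
    have : ¬ i ≤ j := not_le.2 hij
    simp [A, this]
  have hA0 : ∀ i, A i i ≠ 0 := fun i => by
    simpa [A, Y] using hx2 i (Finset.mem_univ i)
  have hA1 : ∀ i j, i ≠ j → A i i ≠ A j j := fun i j hij => by
    simpa [A, Y, sub_eq_zero] using hx3 (i, j) (by simpa using hij)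
  obtain ⟨u, hu⟩ := exists_conj hA hA1
  obtain ⟨g, hg⟩ := hdiag (fun i => Units.mk0 (A i i) (hA0 i)) (fun i j hij e =>
    hA1 i j hij (by simpa using congrArg Units.val e))
  refine ⟨fun i => u * g i * u⁻¹, ?_⟩
  have hconj : FreeGroup.lift (fun i => u * g i * u⁻¹) w = u * FreeGroup.lift g w * u⁻¹ := by
    have : FreeGroup.lift (fun i => u * g i * u⁻¹) =
        (MulAut.conj u).toMonoidHom.comp (FreeGroup.lift g) := by
      ext i
      simp
    rw [this]
    simp
  have huu : ((u : upperTriangularAlg K m) : Matrix (Fin m) (Fin m) K) *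
      (((u⁻¹ : (upperTriangularAlg K m)ˣ) : upperTriangularAlg K m) :
        Matrix (Fin m) (Fin m) K) = 1 := by
    have := congrArg (Subtype.val) (u.mul_inv)
    exact this
  have hval : (((FreeGroup.lift (fun i => u * g i * u⁻¹) w : (upperTriangularAlg K m)ˣ) :
      upperTriangularAlg K m) : Matrix (Fin m) (Fin m) K) = A := by
    rw [hconj, Units.val_mul, Units.val_mul, Subalgebra.coe_mul, Subalgebra.coe_mul, hg]
    simp only [Units.val_mk0]
    rw [← hu, mul_assoc, huu, mul_one]
  rw [hval]
  have hAx : (fun q : {q : Fin m × Fin m // q.1 ≤ q.2} => A q.1.1 q.1.2) = x := by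
    funext q
    simp [A, q.2]
  rw [hAx]
  exact hx1
end
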